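/- arXiv:2501.02677 — 6 statements merged into one kernel-verified Lean document; each statement's English description precedes it below -/
import Mathlib

section
/- Let A, B : ℝ → ℝ be differentiable, let ψ : ℝ → ℝ be nowhere zero, let c₀, c₂, c₃ ∈ ℝ, and let ζ¹ : ℝ → ℝ be differentiable. Suppose the four functions ζ⁰(t,x,y,z) = c₀, ζ¹(t,x,y,z) = ζ¹(x), ζ²(t,x,y,z) = c₂, ζ³(t,x,y,z) = c₃ satisfy the ten conformal Killing equations of the static plane symmetric metric with conformal factor ψ(x). Then ζ¹ is nowhere zero, A'(x) = B'(x) for all x, and there exists a nonzero constant k such that ζ¹(x) = k·e^{A(x)} and ψ(x) = k·A'(x)·e^{A(x)} for all x. -/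
/-- The ten conformal Killing equations of the static plane symmetric metric
`ds² = e^{2A(x)}dt² − dx² − e^{2B(x)}(dy² + dz²)` for a vector field
`ζ = (ζ0, ζ1, ζ2, ζ3)` (functions of the coordinates `(t,x,y,z)`) with
conformal factor `ψ(x)`. -/
def ConformalEqs (A B ψ : ℝ → ℝ) (ζ0 ζ1 ζ2 ζ3 : ℝ → ℝ → ℝ → ℝ → ℝ) : Prop :=
  ∀ t x y z : ℝ,
    -- (i)
    deriv (fun s => ζ0 s x y z) t + deriv A x * ζ1 t x y z = ψ x ∧
    -- (ii)
    Real.exp (2 * A x) * deriv (fun s => ζ0 t s y z) x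
      - deriv (fun s => ζ1 s x y z) t = 0 ∧
    -- (iii)
    Real.exp (2 * A x) * deriv (fun s => ζ0 t x s z) y
      - Real.exp (2 * B x) * deriv (fun s => ζ2 s x y z) t = 0 ∧
    -- (iv)
    Real.exp (2 * A x) * deriv (fun s => ζ0 t x y s) z
      - Real.exp (2 * B x) * deriv (fun s => ζ3 s x y z) t = 0 ∧
    -- (v)
    deriv (fun s => ζ1 t s y z) x = ψ x ∧
    -- (vi)
    Real.exp (2 * B x) * deriv (fun s => ζ2 t s y z) x
      + deriv (fun s => ζ1 t x s z) y = 0 ∧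
    -- (vii)
    Real.exp (2 * B x) * deriv (fun s => ζ3 t s y z) x
      + deriv (fun s => ζ1 t x y s) z = 0 ∧
    -- (viii)
    deriv (fun s => ζ2 t x s z) y + deriv B x * ζ1 t x y z = ψ x ∧
    -- (ix)
    deriv (fun s => ζ2 t x y s) z + deriv (fun s => ζ3 t x s z) y = 0 ∧
    -- (x)
    deriv (fun s => ζ3 t x y s) z + deriv B x * ζ1 t x y z = ψ x

/-- constraint direction of Theorem 2.1: if `ζ⁰ = c₀`,
`ζ¹ = ζ¹(x)`, `ζ² = c₂`, `ζ³ = c₃` satisfy the ten conformal Killing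
equations with nowhere-zero conformal factor `ψ(x)`, then `ζ¹` is nowhere
zero, `A' = B'`, and `ζ¹ = k·e^A`, `ψ = k·A'·e^A` for some nonzero
constant `k`. -/
theorem conformal_ansatz_constraints
    (A B ψ : ℝ → ℝ) (hA : Differentiable ℝ A) (hB : Differentiable ℝ B)
    (hψ : ∀ x, ψ x ≠ 0)
    (c₀ c₂ c₃ : ℝ) (ζ1 : ℝ → ℝ) (hζ1 : Differentiable ℝ ζ1)
    (hCKE : ConformalEqs A B ψ
      (fun _ _ _ _ => c₀) (fun _ x _ _ => ζ1 x)
      (fun _ _ _ _ => c₂) (fun _ _ _ _ => c₃)) :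
    (∀ x, ζ1 x ≠ 0) ∧
    (∀ x, deriv A x = deriv B x) ∧
    ∃ k : ℝ, k ≠ 0 ∧
      ∀ x, ζ1 x = k * Real.exp (A x) ∧ ψ x = k * deriv A x * Real.exp (A x) := by
  have h1 : ∀ x, deriv A x * ζ1 x = ψ x := fun x => by
    have h := (hCKE 0 x 0 0).1
    simpa using h
  have h5 : ∀ x, deriv ζ1 x = ψ x := fun x => (hCKE 0 x 0 0).2.2.2.2.1
  have h8 : ∀ x, deriv B x * ζ1 x = ψ x := fun x => by
    have h := (hCKE 0 x 0 0).2.2.2.2.2.2.2.1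
    simpa using h
  have hne : ∀ x, ζ1 x ≠ 0 := fun x h => hψ x (by rw [← h1 x, h, mul_zero])
  have hd : ∀ x, HasDerivAt (fun s => ζ1 s * Real.exp (-A s)) 0 x := fun x => by
    have h := (hζ1 x).hasDerivAt.mul ((hA x).hasDerivAt.neg.exp)
    refine h.congr_deriv ?_
    rw [h5 x, ← h1 x]
    simp only [Pi.neg_apply]
    ring
  have hc : ∀ x, ζ1 x * Real.exp (-A x) = ζ1 0 * Real.exp (-A 0) := fun x =>
    is_const_of_deriv_eq_zero (fun x => (hd x).differentiableAt) (fun x => (hd x).deriv) x 0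
  have hz : ∀ x, ζ1 x = ζ1 0 * Real.exp (-A 0) * Real.exp (A x) := fun x => by
    rw [← hc x, mul_assoc, ← Real.exp_add]
    simp
  refine ⟨hne, fun x => mul_right_cancel₀ (hne x) ((h1 x).trans (h8 x).symm),
    ζ1 0 * Real.exp (-A 0), mul_ne_zero (hne 0) (Real.exp_ne_zero _), fun x => ⟨hz x, ?_⟩⟩
  rw [← h1 x]
  conv_lhs => rw [hz x]
  ring
end

section
/- Let A, B, ρ, p : ℝ → ℝ with A twice differentiable and A = B, and suppose the perfect-fluid Einstein field equations hold: 3B'² + 2B'' = ρ, B'² + 2A'B' = −p, and B'² + B'' + A'B' + A'² + A'' = −p. Then there exist constants a, b ∈ ℝ such that A(x) = a·x + b for all x, and moreover ρ(x) = 3a² and p(x) = −3a² for all x; in particular the equation of state ρ + p = 0 holds identically. -/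
/-- for the static plane symmetric metric with a perfect-fluid
source, under the conformal-motion constraint `A = B`, the Einstein field
equations force `A(x) = a·x + b`, `ρ = 3a²`, `p = −3a²`, and the equation of
state `ρ + p = 0`. -/
theorem perfect_fluid_conformal_solution
    (A B ρ p : ℝ → ℝ)
    (hA : Differentiable ℝ A) (hA' : Differentiable ℝ (deriv A))
    (hAB : A = B)
    (hE1 : ∀ x, 3 * (deriv B x) ^ 2 + 2 * deriv (deriv B) x = ρ x)
    (hE2 : ∀ x, (deriv B x) ^ 2 + 2 * deriv A x * deriv B x = -p x)
    (hE3 : ∀ x, (deriv B x) ^ 2 + deriv (deriv B) x + deriv A x * deriv B x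
        + (deriv A x) ^ 2 + deriv (deriv A) x = -p x) :
    ∃ a b : ℝ, (∀ x, A x = a * x + b) ∧
      (∀ x, ρ x = 3 * a ^ 2) ∧ (∀ x, p x = -(3 * a ^ 2)) ∧
      (∀ x, ρ x + p x = 0) := by
  subst hAB
  have h2 : ∀ x, deriv (deriv A) x = 0 := fun x => by
    have e2 := hE2 x
    have e3 := hE3 x
    nlinarith
  have h1 : ∀ x, deriv A x = deriv A 0 := fun x =>
    is_const_of_deriv_eq_zero hA' h2 x 0
  have hρ : ∀ x, ρ x = 3 * (deriv A 0) ^ 2 := fun x => by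
    rw [← hE1 x, h2 x, h1 x]; ring
  have hp : ∀ x, p x = -(3 * (deriv A 0) ^ 2) := fun x => by
    have e2 := hE2 x
    rw [h1 x] at e2
    linarith
  refine ⟨deriv A 0, A 0, fun x => ?_, hρ, hp, fun x => by rw [hρ x, hp x]; ring⟩
  have hd : ∀ y, HasDerivAt (fun y => A y - deriv A 0 * y) 0 y := fun y => by
    have h := (hA y).hasDerivAt.sub ((hasDerivAt_id y).const_mul (deriv A 0))
    rw [h1 y, mul_one, sub_self] at h
    exact h
  have hc := is_const_of_deriv_eq_zero (fun y => (hd y).differentiableAt)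
    (fun y => (hd y).deriv) x 0
  simp only [mul_zero, sub_zero] at hc
  linarith
end

section
/- Let I ⊆ ℝ be an open interval, let A, B, λ, μ, μ_p : I → ℝ with A twice differentiable and A = B, and suppose the cosmic-string Einstein field equations hold on I: B'² + 2A'B' = λ, B'² + B'' + A'B' + A'² + A'' = 0, 3B'² + 2B'' = μ, together with μ = μ_p + λ. Then μ(x) = 0 and μ_p(x) = −λ(x) = −3B'(x)² for all x ∈ I. If moreover B' is nowhere zero on I, then there exists a constant c₄ such that for all x ∈ I, λ(x) = 3/((3/2)x + c₄)² and μ_p(x) = −3/((3/2)x + c₄)². -/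
/-- for the static plane symmetric metric sourced by a cosmic
string cloud, with the conformal-motion constraint `A = B`, the Einstein field
equations give `μ = 0` and `μ_p = −λ = −3B'²` on `I`; if moreover `B'` is
nowhere zero on `I`, then `λ(x) = 3/((3/2)x + c₄)²` and
`μ_p(x) = −3/((3/2)x + c₄)²` for some constant `c₄`. -/
theorem string_cloud_conformal_solution
    (I : Set ℝ) (hIopen : IsOpen I) (hIconv : Convex ℝ I)
    (A B lam μ μp : ℝ → ℝ)
    (hA1 : ∀ x ∈ I, DifferentiableAt ℝ A x)
    (hA2 : ∀ x ∈ I, DifferentiableAt ℝ (deriv A) x)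
    (hAB : A = B)
    (hE1 : ∀ x ∈ I, (deriv B x) ^ 2 + 2 * deriv A x * deriv B x = lam x)
    (hE2 : ∀ x ∈ I, (deriv B x) ^ 2 + deriv (deriv B) x + deriv A x * deriv B x
        + (deriv A x) ^ 2 + deriv (deriv A) x = 0)
    (hE3 : ∀ x ∈ I, 3 * (deriv B x) ^ 2 + 2 * deriv (deriv B) x = μ x)
    (hμ : ∀ x ∈ I, μ x = μp x + lam x) :
    (∀ x ∈ I, μ x = 0 ∧ μp x = -lam x ∧ lam x = 3 * (deriv B x) ^ 2) ∧
    ((∀ x ∈ I, deriv B x ≠ 0) →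
      ∃ c₄ : ℝ, ∀ x ∈ I,
        lam x = 3 / (3 / 2 * x + c₄) ^ 2 ∧
        μp x = -(3 / (3 / 2 * x + c₄) ^ 2)) := by
  subst hAB
  have h1 : ∀ x ∈ I, μ x = 0 ∧ μp x = -lam x ∧ lam x = 3 * (deriv A x) ^ 2 := by
    intro x hx
    have e1 := hE1 x hx
    have e2 := hE2 x hx
    have e3 := hE3 x hx
    have e4 := hμ x hx
    have m0 : μ x = 0 := by nlinarith
    exact ⟨m0, by linarith, by nlinarith⟩
  refine ⟨h1, fun hne => ?_⟩
  have hd : ∀ x ∈ I, HasDerivAt (fun y => (deriv A y)⁻¹ - 3 / 2 * y) 0 x := by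
    intro x hx
    have h := ((hA2 x hx).hasDerivAt.fun_inv (hne x hx)).sub
      ((hasDerivAt_id x).const_mul (3 / 2 : ℝ))
    have e2 := hE2 x hx
    have hn := hne x hx
    have e : deriv (deriv A) x = -(3 / 2) * (deriv A x) ^ 2 := by nlinarith
    refine h.congr_deriv ?_
    rw [e]
    field_simp
    ring
  obtain ⟨c, hc⟩ := hIopen.exists_is_const_of_deriv_eq_zero hIconv.isPreconnected
    (fun x hx => (hd x hx).differentiableAt.differentiableWithinAt)
    (fun x hx => (hd x hx).deriv)
  refine ⟨c, fun x hx => ?_⟩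
  obtain ⟨_, hp, hl⟩ := h1 x hx
  have hcx := hc x hx
  have e : 3 / 2 * x + c = (deriv A x)⁻¹ := by
    rw [← hcx]; ring
  have hl' : lam x = 3 / (3 / 2 * x + c) ^ 2 := by
    rw [e, hl, inv_pow, div_inv_eq_mul]
  exact ⟨hl', by rw [hp, hl']⟩
end

section
/- Let A : ℝ → ℝ be twice differentiable, let ψ : ℝ → ℝ be nowhere zero, and let ζ¹ : ℝ → ℝ be differentiable, satisfying the reduced orthogonal conformal equations A'(x)·ζ¹(x) = ψ(x) and (ζ¹)'(x) = ψ(x) for all x. Suppose moreover that with B = A there exist ρ, p : ℝ → ℝ satisfying the perfect-fluid Einstein equations 3B'² + 2B'' = ρ, B'² + 2A'B' = −p, and B'² + B'' + A'B' + A'² + A'' = −p. Then there exist constants a ≠ 0, b ∈ ℝ, and k ≠ 0 such that for all x: A(x) = a·x + b, ψ(x) = k·e^{a·x}, ζ¹(x) = (k/a)·e^{a·x}, and ρ(x) = 3a² = −p(x). -/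
/-- Proposition 5.1: perfect fluid solutions admitting a
conformal Killing vector orthogonal to the four-velocity (reduced equations
`A'·ζ¹ = ψ`, `(ζ¹)' = ψ` with nowhere-zero `ψ`, constraint `B = A`, and the
perfect-fluid Einstein equations) have `A(x) = a·x + b` with `a ≠ 0`,
`ψ(x) = k·e^{a·x}`, `ζ¹(x) = (k/a)·e^{a·x}`, and `ρ = 3a² = −p`. -/
theorem orthogonal_conformal_perfect_fluid
    (A B ψ ζ1 ρ p : ℝ → ℝ)
    (hA : Differentiable ℝ A) (hA' : Differentiable ℝ (deriv A))
    (hψ : ∀ x, ψ x ≠ 0)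
    (hζ1 : Differentiable ℝ ζ1)
    (heq1 : ∀ x, deriv A x * ζ1 x = ψ x)
    (heq2 : ∀ x, deriv ζ1 x = ψ x)
    (hBA : B = A)
    (hE1 : ∀ x, 3 * (deriv B x) ^ 2 + 2 * deriv (deriv B) x = ρ x)
    (hE2 : ∀ x, (deriv B x) ^ 2 + 2 * deriv A x * deriv B x = -p x)
    (hE3 : ∀ x, (deriv B x) ^ 2 + deriv (deriv B) x + deriv A x * deriv B x
        + (deriv A x) ^ 2 + deriv (deriv A) x = -p x) :
    ∃ a b k : ℝ, a ≠ 0 ∧ k ≠ 0 ∧ ∀ x,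
      A x = a * x + b ∧
      ψ x = k * Real.exp (a * x) ∧
      ζ1 x = (k / a) * Real.exp (a * x) ∧
      ρ x = 3 * a ^ 2 ∧ p x = -(3 * a ^ 2) := by
  subst hBA
  have h2 : ∀ x, deriv (deriv B) x = 0 := fun x => by
    have := hE2 x
    have := hE3 x
    nlinarith
  have hc : ∀ x, deriv B x = deriv B 0 := fun x => is_const_of_deriv_eq_zero hA' h2 x 0
  obtain ⟨a, ha⟩ : ∃ a, a = deriv B 0 := ⟨_, rfl⟩
  rw [← ha] at hc
  have ha0 : a ≠ 0 := by
    rintro rfl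
    apply hψ 0
    rw [← heq1 0, hc 0, zero_mul]
  have hlin : ∀ x, B x - a * x = B 0 - a * 0 := by
    have hd : ∀ x, HasDerivAt (fun x => B x - a * x) 0 x := fun x => by
      have h := (hA x).hasDerivAt.sub ((hasDerivAt_id x).const_mul a)
      rw [hc x] at h
      exact h.congr_deriv (by simp)
    intro x
    exact is_const_of_deriv_eq_zero (fun x => (hd x).differentiableAt) (fun x => (hd x).deriv) x 0
  have hexp : ∀ x, ζ1 x * Real.exp (-(a * x)) = ζ1 0 * Real.exp (-(a * 0)) := by
    have hd : ∀ x, HasDerivAt (fun x => ζ1 x * Real.exp (-(a * x))) 0 x := fun x => by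
      have h := (hζ1 x).hasDerivAt.mul (((hasDerivAt_id x).const_mul a).neg.exp)
      rw [heq2 x, ← heq1 x, hc x] at h
      refine h.congr_deriv ?_
      simp
      ring
    intro x
    exact is_const_of_deriv_eq_zero (fun x => (hd x).differentiableAt) (fun x => (hd x).deriv) x 0
  have hz : ∀ x, ζ1 x = ζ1 0 * Real.exp (a * x) := fun x => by
    have h := hexp x
    rw [mul_zero, neg_zero, Real.exp_zero, mul_one] at h
    rw [← h, mul_assoc, ← Real.exp_add]
    simp
  have hp0 : a * ζ1 0 = ψ 0 := by rw [← heq1 0, hc 0]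
  refine ⟨a, B 0, a * ζ1 0, ha0, hp0 ▸ hψ 0, fun x => ⟨?_, ?_, ?_, ?_, ?_⟩⟩
  · linarith [hlin x]
  · rw [← heq1 x, hc x, hz x]; ring
  · rw [mul_div_cancel_left₀ _ ha0]; exact hz x
  · rw [← hE1 x, h2 x, hc x]; ring
  · have := hE2 x
    rw [hc x] at this
    linarith
end

section
/- Let A, B : ℝ → ℝ be differentiable, ψ : ℝ → ℝ, and let ζ⁰ : ℝ⁴ → ℝ be differentiable. Suppose the vector field with components (ζ⁰, 0, 0, 0) (i.e., ζ parallel to the four-velocity u, with ζ¹ = ζ² = ζ³ = 0) satisfies the ten conformal Killing equations of the static plane symmetric metric with conformal factor ψ(x). Then ψ(x) = 0 for all x, and all four partial derivatives of ζ⁰ vanish identically, so ζ⁰ is constant; hence the static plane symmetric space-time admits no proper conformal vector field parallel to the four-velocity vector. -/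
/-- if a vector field parallel to the four-velocity,
`ζ = (ζ⁰, 0, 0, 0)`, satisfies the ten conformal Killing equations with
conformal factor `ψ(x)`, then `ψ ≡ 0`, all partial derivatives of `ζ⁰`
vanish, and `ζ⁰` is constant: the space-time admits no proper conformal
vector field parallel to the four-velocity. -/
theorem no_proper_conformal_vector_parallel_to_velocity
    (A B ψ : ℝ → ℝ) (hA : Differentiable ℝ A) (hB : Differentiable ℝ B)
    (ζ0 : ℝ → ℝ → ℝ → ℝ → ℝ)
    (hζ0 : Differentiable ℝ (fun p : ℝ × ℝ × ℝ × ℝ => ζ0 p.1 p.2.1 p.2.2.1 p.2.2.2))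
    (hCKE : ConformalEqs A B ψ ζ0
      (fun _ _ _ _ => 0) (fun _ _ _ _ => 0) (fun _ _ _ _ => 0)) :
    (∀ x, ψ x = 0) ∧
    (∀ t x y z : ℝ,
      deriv (fun s => ζ0 s x y z) t = 0 ∧
      deriv (fun s => ζ0 t s y z) x = 0 ∧
      deriv (fun s => ζ0 t x s z) y = 0 ∧
      deriv (fun s => ζ0 t x y s) z = 0) ∧
    ∃ c : ℝ, ∀ t x y z : ℝ, ζ0 t x y z = c := by
  have hψ : ∀ x, ψ x = 0 := by
    intro x
    obtain ⟨-, -, -, -, h, -⟩ := hCKE 0 x 0 0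
    simpa using h.symm
  have hd : ∀ t x y z : ℝ,
      deriv (fun s => ζ0 s x y z) t = 0 ∧
      deriv (fun s => ζ0 t s y z) x = 0 ∧
      deriv (fun s => ζ0 t x s z) y = 0 ∧
      deriv (fun s => ζ0 t x y s) z = 0 := by
    intro t x y z
    obtain ⟨h1, h2, h3, h4, -⟩ := hCKE t x y z
    refine ⟨?_, ?_, ?_, ?_⟩
    · simpa [hψ] using h1
    · simpa using h2
    · simpa using h3
    · simpa using h4
  refine ⟨hψ, hd, ζ0 0 0 0 0, ?_⟩
  intro t x y z
  have e1 : ζ0 t x y z = ζ0 0 x y z :=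
    is_const_of_deriv_eq_zero (f := fun s => ζ0 s x y z)
      (hζ0.comp (by fun_prop : Differentiable ℝ (fun s : ℝ => (s, x, y, z))))
      (fun s => (hd s x y z).1) t 0
  have e2 : ζ0 0 x y z = ζ0 0 0 y z :=
    is_const_of_deriv_eq_zero (f := fun s => ζ0 0 s y z)
      (hζ0.comp (by fun_prop : Differentiable ℝ (fun s : ℝ => ((0 : ℝ), s, y, z))))
      (fun s => (hd 0 s y z).2.1) x 0
  have e3 : ζ0 0 0 y z = ζ0 0 0 0 z :=
    is_const_of_deriv_eq_zero (f := fun s => ζ0 0 0 s z)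
      (hζ0.comp (by fun_prop : Differentiable ℝ (fun s : ℝ => ((0 : ℝ), (0 : ℝ), s, z))))
      (fun s => (hd 0 0 s z).2.2.1) y 0
  have e4 : ζ0 0 0 0 z = ζ0 0 0 0 0 :=
    is_const_of_deriv_eq_zero (f := fun s => ζ0 0 0 0 s)
      (hζ0.comp (by fun_prop :
        Differentiable ℝ (fun s : ℝ => ((0 : ℝ), (0 : ℝ), (0 : ℝ), s))))
      (fun s => (hd 0 0 0 s).2.2.2) z 0
  rw [e1, e2, e3, e4]
end

section
/- Let A, B : ℝ → ℝ be differentiable with A'(x) ≠ 0 for all x, let ψ : ℝ → ℝ, and let ζ¹, ζ², ζ³ : ℝ⁴ → ℝ be differentiable. Suppose the vector field with components (0, ζ¹, ζ², ζ³) (i.e., ζ orthogonal to the four-velocity u, with ζ⁰ = 0) satisfies the ten conformal Killing equations of the static plane symmetric metric with conformal factor ψ(x). Then: (a) ∂ₜζ¹ = ∂ₜζ² = ∂ₜζ³ = 0; (b) ζ¹(t,x,y,z) = ψ(x)/A'(x) for all (t,x,y,z), so ζ¹ depends only on x; (c) ∂ₓζ² = ∂ₓζ³ = 0; (d) the function x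 ↦ ψ(x)/A'(x) is differentiable with derivative ψ(x); and (e) ∂_yζ² = ∂_zζ³ = ψ − B'·(ψ/A'). -/
/-- if a vector field orthogonal to the four-velocity,
`ζ = (0, ζ¹, ζ², ζ³)`, satisfies the ten conformal Killing equations with
conformal factor `ψ(x)`, and `A'` is nowhere zero, then: (a) `ζ¹, ζ², ζ³`
are time-independent; (b) `ζ¹ = ψ/A'` depends only on `x`; (c) `ζ²` and `ζ³`
are independent of `x`; (d) `x ↦ ψ(x)/A'(x)` has derivative `ψ(x)`; and
(e) `∂_yζ² = ∂_zζ³ = ψ − B'·(ψ/A')`. -/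
theorem orthogonal_conformal_vector_structure
    (A B ψ : ℝ → ℝ) (hA : Differentiable ℝ A) (hB : Differentiable ℝ B)
    (hA' : ∀ x, deriv A x ≠ 0)
    (ζ1 ζ2 ζ3 : ℝ → ℝ → ℝ → ℝ → ℝ)
    (hζ1 : Differentiable ℝ (fun p : ℝ × ℝ × ℝ × ℝ => ζ1 p.1 p.2.1 p.2.2.1 p.2.2.2))
    (hζ2 : Differentiable ℝ (fun p : ℝ × ℝ × ℝ × ℝ => ζ2 p.1 p.2.1 p.2.2.1 p.2.2.2))
    (hζ3 : Differentiable ℝ (fun p : ℝ × ℝ × ℝ × ℝ => ζ3 p.1 p.2.1 p.2.2.1 p.2.2.2))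
    (hCKE : ConformalEqs A B ψ (fun _ _ _ _ => 0) ζ1 ζ2 ζ3) :
    -- (a) time-independence
    (∀ t x y z : ℝ,
      deriv (fun s => ζ1 s x y z) t = 0 ∧
      deriv (fun s => ζ2 s x y z) t = 0 ∧
      deriv (fun s => ζ3 s x y z) t = 0) ∧
    -- (b) ζ¹ = ψ/A' depends only on x
    (∀ t x y z : ℝ, ζ1 t x y z = ψ x / deriv A x) ∧
    -- (c) ζ², ζ³ independent of x
    (∀ t x y z : ℝ,
      deriv (fun s => ζ2 t s y z) x = 0 ∧
      deriv (fun s => ζ3 t s y z) x = 0) ∧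
    -- (d) derivative of ψ/A' is ψ
    (∀ x : ℝ, HasDerivAt (fun s => ψ s / deriv A s) (ψ x) x) ∧
    -- (e)
    (∀ t x y z : ℝ,
      deriv (fun s => ζ2 t x s z) y = ψ x - deriv B x * (ψ x / deriv A x) ∧
      deriv (fun s => ζ3 t x y s) z = ψ x - deriv B x * (ψ x / deriv A x)) := by
  have hb : ∀ t x y z : ℝ, ζ1 t x y z = ψ x / deriv A x := by
    intro t x y z
    have h := (hCKE t x y z).1
    simp only [deriv_const, zero_add] at h
    rw [eq_div_iff (hA' x), ← h, mul_comm]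
  have hd : ∀ x : ℝ, HasDerivAt (fun s => ψ s / deriv A s) (ψ x) x := by
    intro x
    have h5 := (hCKE 0 x 0 0).2.2.2.2.1
    have hdiff : DifferentiableAt ℝ (fun s => ζ1 0 s 0 0) x := by
      have hg : Differentiable ℝ (fun s : ℝ => ((0, s, 0, 0) : ℝ × ℝ × ℝ × ℝ)) := by fun_prop
      exact (hζ1.comp hg) x
    have h := hdiff.hasDerivAt
    rw [h5] at h
    have he : (fun s => ζ1 0 s 0 0) = fun s => ψ s / deriv A s := funext fun s => hb 0 s 0 0
    rwa [he] at h
  refine ⟨fun t x y z => ?_, hb, fun t x y z => ?_, hd, fun t x y z => ?_⟩ <;>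
    obtain ⟨h1, h2, h3, h4, h5, h6, h7, h8, h9, h10⟩ := hCKE t x y z
  · simp only [deriv_const, mul_zero, zero_sub, neg_eq_zero, mul_eq_zero, Real.exp_ne_zero,
      false_or] at h2 h3 h4
    exact ⟨h2, h3, h4⟩
  · simp only [hb, deriv_const, add_zero, mul_eq_zero, Real.exp_ne_zero, false_or] at h6 h7
    exact ⟨h6, h7⟩
  · rw [hb] at h8 h10
    exact ⟨by linarith, by linarith⟩
end
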